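/- Under the smoothness and convexity assumptions, let 0 < μ⁺ ≤ μ ≤ 1/2 with μ ≤ 2μ⁺, and let x, x⁺ ∈ ℝⁿ. Then (i) ‖y*_μ(x) − y*_{μ⁺}(x⁺)‖² ≤ (2L_{ψy1}²/σ_{ψμ}²) ‖x − x⁺‖² + (8‖∇_y F(x⁺, y*_{μ⁺}(x⁺))‖²/σ_F²) ((μ − μ⁺)/μ)², and (ii) ‖v*_μ(x) − v*_{μ⁺}(x⁺)‖² ≤ (2(L_{v1}‖v*_μ(x)‖ + L_{v2})²/σ_{ψμ}⁴) ‖x − x⁺‖² + 2(C_{v1}‖v*_{μ⁺}(x⁺)‖ + C_{v2})² ‖∇_y F(x⁺, y*_{μ⁺}(x⁺))‖² ((μ − μ⁺)/μ²)². -/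

import Mathlib

open Set Filter Asymptotics
open scoped NNReal

noncomputable section

/-- `ℝⁿ` as a Euclidean space. -/
abbrev Eu (n : ℕ) : Type := EuclideanSpace ℝ (Fin n)

variable {n m : ℕ}

/-- Partial gradient with respect to the first (upper-level) variable. -/
def gradx (F : Eu n → Eu m → ℝ) (x : Eu n) (y : Eu m) : Eu n :=
  gradient (fun x' => F x' y) x

/-- Partial gradient with respect to the second (lower-level) variable. -/
def grady (F : Eu n → Eu m → ℝ) (x : Eu n) (y : Eu m) : Eu m :=
  gradient (fun y' => F x y') y

/-- Second-order partial derivative `∇²_{yy}`. -/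
def hessyy (F : Eu n → Eu m → ℝ) (x : Eu n) (y : Eu m) : Eu m →L[ℝ] Eu m :=
  fderiv ℝ (fun y' => grady F x y') y

/-- Mixed second-order partial derivative `∇²_{xy}`, viewed as the linear map
sending a multiplier `v ∈ ℝᵐ` to an element of `ℝⁿ`. -/
def hessxy (F : Eu n → Eu m → ℝ) (x : Eu n) (y : Eu m) : Eu m →L[ℝ] Eu n :=
  ContinuousLinearMap.adjoint (fderiv ℝ (fun x' => grady F x' y) x)

/-- The aggregation function `ψ_μ = μ F + (1-μ) f`. -/
def aggreg (μ : ℝ) (F f : Eu n → Eu m → ℝ) : Eu n → Eu m → ℝ :=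
  fun x y => μ * F x y + (1 - μ) * f x y

/-- The squared KKT residual of the equality-constrained reformulation
`min F(x,y) s.t. ∇_y f(x,y) = 0`. -/
def KKTres (F f : Eu n → Eu m → ℝ) (x : Eu n) (y v : Eu m) : ℝ :=
  ‖gradx F x y - hessxy f x y v‖ ^ 2 + ‖grady F x y - hessyy f x y v‖ ^ 2 +
    ‖grady f x y‖ ^ 2

section Convexity

variable {E : Type*} [NormedAddCommGroup E] [InnerProductSpace ℝ E]

/-- The gradient of a strongly convex function is strongly monotone. -/
lemma StrongConvexOn.le_inner_gradient_sub [CompleteSpace E] {g : E → ℝ} {σ : ℝ}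
    (hg : StrongConvexOn univ σ g) (hd : Differentiable ℝ g) (a b : E) :
    σ * ‖a - b‖ ^ 2 ≤ inner ℝ (gradient g a - gradient g b) (a - b) := by
  have hc : ConvexOn ℝ univ fun y => g y - σ / 2 * ‖y‖ ^ 2 := strongConvexOn_iff_convex.1 hg
  have hφ : ConvexOn ℝ univ
      ((fun y => g y - σ / 2 * ‖y‖ ^ 2) ∘ AffineMap.lineMap (k := ℝ) b a) := by
    simpa using hc.comp_affineMap (AffineMap.lineMap (k := ℝ) b a)
  have hder : ∀ t : ℝ, HasDerivAt
      ((fun y => g y - σ / 2 * ‖y‖ ^ 2) ∘ AffineMap.lineMap (k := ℝ) b a)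
      (inner ℝ (gradient g (AffineMap.lineMap b a t)) (a - b)
        - σ * inner ℝ (AffineMap.lineMap b a t) (a - b)) t := by
    intro t
    have h1 : HasDerivAt (AffineMap.lineMap (k := ℝ) b a) (a - b) t :=
      AffineMap.hasDerivAt_lineMap
    have h2 := ((hd (AffineMap.lineMap b a t)).hasFDerivAt).comp_hasDerivAt t h1
    have h3 := (h1.norm_sq).const_mul (σ / 2)
    refine (h2.sub h3).congr_deriv ?_
    rw [inner_gradient_left]
    ring
  have h0 := hφ.le_slope_of_hasDerivAt (mem_univ 0) (mem_univ 1) one_pos (hder 0)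
  have h1 := hφ.slope_le_of_hasDerivAt (mem_univ 0) (mem_univ 1) one_pos (hder 1)
  have h := h0.trans h1
  simp only [AffineMap.lineMap_apply_zero, AffineMap.lineMap_apply_one] at h
  have hn : ‖a - b‖ ^ 2 = inner ℝ a (a - b) - inner ℝ b (a - b) := by
    rw [← inner_sub_left, real_inner_self_eq_norm_sq]
  rw [hn, inner_sub_left]
  linarith

/-- The derivative of a strongly monotone map is coercive. -/
lemma le_inner_of_hasFDerivAt_of_strongly_monotone {G : E → E} {G' : E →L[ℝ] E} {σ : ℝ} {y : E}
    (hG : HasFDerivAt G G' y)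
    (hmono : ∀ a b, σ * ‖a - b‖ ^ 2 ≤ inner ℝ (G a - G b) (a - b)) (u : E) :
    σ * ‖u‖ ^ 2 ≤ inner ℝ (G' u) u := by
  have h1 : HasDerivAt (fun t : ℝ => y + t • u) u 0 := by
    simpa using ((hasDerivAt_id (0 : ℝ)).smul_const u).const_add y
  have hG0 : HasFDerivAt G G' (y + (0 : ℝ) • u) := by simpa using hG
  have h2 : HasDerivAt (fun t : ℝ => G (y + t • u)) (G' u) 0 :=
    hG0.comp_hasDerivAt (f := fun t : ℝ => y + t • u) 0 h1
  have h3 : HasDerivAt (fun t : ℝ => inner ℝ (G (y + t • u)) u - t * (σ * ‖u‖ ^ 2))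
      (inner ℝ (G' u) u - σ * ‖u‖ ^ 2) 0 := by
    refine ((h2.inner ℝ (hasDerivAt_const (0 : ℝ) u)).sub
      ((hasDerivAt_id (0 : ℝ)).mul_const (σ * ‖u‖ ^ 2))).congr_deriv ?_
    simp
  have hm : Monotone fun t : ℝ => inner ℝ (G (y + t • u)) u - t * (σ * ‖u‖ ^ 2) := by
    intro s t hst
    rcases hst.eq_or_lt with rfl | hlt
    · exact le_rfl
    have h := hmono (y + t • u) (y + s • u)
    have he : y + t • u - (y + s • u) = (t - s) • u := by module
    rw [he, inner_smul_right, norm_smul, mul_pow, Real.norm_eq_abs, sq_abs,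
      inner_sub_left] at h
    have hts : 0 < t - s := sub_pos.2 hlt
    have h' : (t - s) * (σ * ‖u‖ ^ 2) ≤
        inner ℝ (G (y + t • u)) u - inner ℝ (G (y + s • u)) u :=
      le_of_mul_le_mul_left (by linarith) hts
    simp only
    linarith
  have := h3.deriv ▸ hm.deriv_nonneg (x := 0)
  linarith

lemma mul_norm_le_of_mul_sq_le_inner {σ : ℝ} {g u : E}
    (h : σ * ‖u‖ ^ 2 ≤ inner ℝ g u) : σ * ‖u‖ ≤ ‖g‖ := by
  rcases (norm_nonneg u).eq_or_lt with hu | hu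
  · simp [← hu]
  · refine le_of_mul_le_mul_right ?_ hu
    linarith [real_inner_le_norm g u]

lemma ContinuousLinearMap.isInvertible_of_coercive [FiniteDimensional ℝ E] {A : E →L[ℝ] E}
    {σ : ℝ} (hσ : 0 < σ) (h : ∀ u, σ * ‖u‖ ^ 2 ≤ inner ℝ (A u) u) : A.IsInvertible := by
  have hinj : Function.Injective (A : E →ₗ[ℝ] E) := by
    rw [injective_iff_map_eq_zero]
    intro u hu
    have h1 := mul_norm_le_of_mul_sq_le_inner (h u)
    rw [show A u = 0 from hu, norm_zero] at h1
    exact norm_le_zero_iff.1 (by nlinarith [norm_nonneg u])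
  exact ⟨(LinearEquiv.ofInjectiveEndo _ hinj).toContinuousLinearEquiv, by ext; rfl⟩

end Convexity

section PartialDerivatives

variable {F f : Eu n → Eu m → ℝ}

lemma contDiff_partial_right (hF : ContDiff ℝ 2 (Function.uncurry F)) (x : Eu n) :
    ContDiff ℝ 2 (F x) :=
  hF.comp (contDiff_const.prodMk contDiff_id)

lemma differentiable_partial_right (hF : ContDiff ℝ 2 (Function.uncurry F)) (x : Eu n) :
    Differentiable ℝ (F x) :=
  (contDiff_partial_right hF x).differentiable (by norm_num)

lemma differentiable_grady (hF : ContDiff ℝ 2 (Function.uncurry F)) (x : Eu n) :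
    Differentiable ℝ (grady F x) := by
  have h : ContDiff ℝ 1 (fderiv ℝ (F x)) :=
    (contDiff_partial_right hF x).fderiv_right (by norm_num)
  exact (InnerProductSpace.toDual ℝ (Eu m)).symm.toContinuousLinearEquiv.differentiable.comp
    (h.differentiable (by norm_num))

lemma grady_aggreg (hF : ContDiff ℝ 2 (Function.uncurry F))
    (hf : ContDiff ℝ 2 (Function.uncurry f)) (μ : ℝ) (x : Eu n) (y : Eu m) :
    grady (aggreg μ F f) x y = μ • grady F x y + (1 - μ) • grady f x y := by
  refine HasGradientAt.gradient (hasGradientAt_iff_hasFDerivAt.2 ?_)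
  have h := (((differentiable_partial_right hF x y).hasFDerivAt).const_mul μ).add
    (((differentiable_partial_right hf x y).hasFDerivAt).const_mul (1 - μ))
  refine h.congr_fderiv ?_
  ext u
  simp [grady]

lemma hasFDerivAt_grady_aggreg (hF : ContDiff ℝ 2 (Function.uncurry F))
    (hf : ContDiff ℝ 2 (Function.uncurry f)) (μ : ℝ) (x : Eu n) (y : Eu m) :
    HasFDerivAt (grady (aggreg μ F f) x) (μ • hessyy F x y + (1 - μ) • hessyy f x y) y := by
  rw [show grady (aggreg μ F f) x = fun y => μ • grady F x y + (1 - μ) • grady f x y from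
    funext fun y => grady_aggreg hF hf μ x y]
  exact ((differentiable_grady hF x y).hasFDerivAt.const_smul μ).add
    ((differentiable_grady hf x y).hasFDerivAt.const_smul (1 - μ))

lemma hessyy_aggreg (hF : ContDiff ℝ 2 (Function.uncurry F))
    (hf : ContDiff ℝ 2 (Function.uncurry f)) (μ : ℝ) (x : Eu n) (y : Eu m) :
    hessyy (aggreg μ F f) x y = μ • hessyy F x y + (1 - μ) • hessyy f x y :=
  (hasFDerivAt_grady_aggreg hF hf μ x y).fderiv

lemma grady_eq_zero_of_forall_le {x : Eu n} {y : Eu m} (h : ∀ z, F x y ≤ F x z) :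
    grady F x y = 0 := by
  have h0 : fderiv ℝ (F x) y = 0 :=
    IsLocalMin.fderiv_eq_zero (Filter.Eventually.of_forall h)
  change gradient (F x) y = 0
  rw [gradient, h0, map_zero]

lemma le_inner_grady_aggreg_sub (hF : ContDiff ℝ 2 (Function.uncurry F))
    (hf : ContDiff ℝ 2 (Function.uncurry f)) {σ μ : ℝ} {x : Eu n} (hμ : μ ∈ Icc (0 : ℝ) 1)
    (hFsc : StrongConvexOn univ σ (F x)) (hfconv : ConvexOn ℝ univ (f x)) (a b : Eu m) :
    μ * σ * ‖a - b‖ ^ 2 ≤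
      inner ℝ (grady (aggreg μ F f) x a - grady (aggreg μ F f) x b) (a - b) := by
  have h1 := hFsc.le_inner_gradient_sub (differentiable_partial_right hF x) a b
  have h2 := (strongConvexOn_zero.2 hfconv).le_inner_gradient_sub
    (differentiable_partial_right hf x) a b
  change _ ≤ inner ℝ (grady F x a - grady F x b) (a - b) at h1
  change _ ≤ inner ℝ (grady f x a - grady f x b) (a - b) at h2
  have he : grady (aggreg μ F f) x a - grady (aggreg μ F f) x b =
      μ • (grady F x a - grady F x b) + (1 - μ) • (grady f x a - grady f x b) := by
    rw [grady_aggreg hF hf, grady_aggreg hF hf]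
    module
  rw [he, inner_add_left, real_inner_smul_left, real_inner_smul_left]
  have h3 := mul_le_mul_of_nonneg_left h1 hμ.1
  have h4 := mul_le_mul_of_nonneg_left h2 (sub_nonneg.2 hμ.2)
  linarith

end PartialDerivatives

/-- The aggregate of two Lipschitz maps is Lipschitz. -/
lemma norm_aggregate_sub_le {X V : Type*} [SeminormedAddCommGroup X] [NormedAddCommGroup V]
    [NormedSpace ℝ V] {g h : X → V} {K L : ℝ≥0} (hg : LipschitzWith K g)
    (hh : LipschitzWith L h) {μ : ℝ} (hμ : μ ∈ Icc (0 : ℝ) 1) (a b : X) :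
    ‖(μ • g a + (1 - μ) • h a) - (μ • g b + (1 - μ) • h b)‖ ≤
      (μ * K + (1 - μ) * L) * ‖a - b‖ := by
  have he : (μ • g a + (1 - μ) • h a) - (μ • g b + (1 - μ) • h b) =
      μ • (g a - g b) + (1 - μ) • (h a - h b) := by module
  rw [he]
  refine (norm_add_le _ _).trans ?_
  rw [norm_smul, norm_smul, Real.norm_of_nonneg hμ.1, Real.norm_of_nonneg (sub_nonneg.2 hμ.2)]
  have h1 := mul_le_mul_of_nonneg_left (hg.norm_sub_le a b) hμ.1
  have h2 := mul_le_mul_of_nonneg_left (hh.norm_sub_le a b) (sub_nonneg.2 hμ.2)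
  linarith

lemma sq_norm_sub_le_of_le {V : Type*} [SeminormedAddCommGroup V] {a b c : V} {p q : ℝ}
    (hp : ‖a - b‖ ≤ p) (hq : ‖b - c‖ ≤ q) : ‖a - c‖ ^ 2 ≤ 2 * p ^ 2 + 2 * q ^ 2 := by
  have h : ‖a - c‖ ≤ p + q := (norm_sub_le_norm_sub_add_norm_sub a b c).trans (add_le_add hp hq)
  nlinarith [norm_nonneg (a - c), sq_nonneg (p - q), pow_le_pow_left₀ (norm_nonneg _) h 2]

/-- Lemma D.5: two-point bounds for `y*` and `v*` under joint changes
of the aggregation parameter and the upper-level variable. -/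
theorem ystar_vstar_joint_smoothness {n m : ℕ}
    (F f : Eu n → Eu m → ℝ)
    (hF : ContDiff ℝ 2 (Function.uncurry F))
    (hf : ContDiff ℝ 2 (Function.uncurry f))
    (LFy1 LFy2 Lfy1 Lfy2 LFyy1 LFyy2 Lfyy1 Lfyy2 : ℝ≥0)
    (hLFy1 : ∀ y, LipschitzWith LFy1 fun x => grady F x y)
    (hLFy2 : ∀ x, LipschitzWith LFy2 fun y => grady F x y)
    (hLfy1 : ∀ y, LipschitzWith Lfy1 fun x => grady f x y)
    (hLfy2 : ∀ x, LipschitzWith Lfy2 fun y => grady f x y)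
    (hLFyy1 : ∀ y, LipschitzWith LFyy1 fun x => hessyy F x y)
    (hLFyy2 : ∀ x, LipschitzWith LFyy2 fun y => hessyy F x y)
    (hLfyy1 : ∀ y, LipschitzWith Lfyy1 fun x => hessyy f x y)
    (hLfyy2 : ∀ x, LipschitzWith Lfyy2 fun y => hessyy f x y)
    (σF : ℝ) (hσF : 0 < σF)
    (hFsc : ∀ x, StrongConvexOn univ σF (F x))
    (hfconv : ∀ x, ConvexOn ℝ univ (f x))
    (ystar : ℝ → Eu n → Eu m)
    (hmin : ∀ μ' ∈ Ioc (0 : ℝ) 1, ∀ x y,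
      aggreg μ' F f x (ystar μ' x) ≤ aggreg μ' F f x y)
    (vstar : ℝ → Eu n → Eu m)
    (hvstar : ∀ μ' x, vstar μ' x =
      (hessyy (aggreg μ' F f) x (ystar μ' x)).inverse (grady F x (ystar μ' x)))
    (μ μplus : ℝ) (hμplus : 0 < μplus) (hle : μplus ≤ μ) (hμhalf : μ ≤ 1 / 2)
    (hμ2 : μ ≤ 2 * μplus)
    (σψ : ℝ) (hσψ : σψ = μ * σF)
    (Lψy1 Lψyy1 Lψyy2 Lv1 Lv2 Cv1 Cv2 : ℝ)
    (hLψy1 : Lψy1 = μ * LFy1 + (1 - μ) * Lfy1)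
    (hLψyy1 : Lψyy1 = μ * LFyy1 + (1 - μ) * Lfyy1)
    (hLψyy2 : Lψyy2 = μ * LFyy2 + (1 - μ) * Lfyy2)
    (hLv1 : Lv1 = Lψyy2 * Lψy1 + Lψyy1 * σψ)
    (hLv2 : Lv2 = LFy2 * Lψy1 + LFy1 * σψ)
    (hCv1 : Cv1 = 2 * (LFyy2 + Lfyy2) / σF ^ 2)
    (hCv2 : Cv2 = 2 * (2 * LFy2 + Lfy2) / σF ^ 2) :
    ∀ (x xp : Eu n),
      ‖ystar μ x - ystar μplus xp‖ ^ 2 ≤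
        (2 * Lψy1 ^ 2 / σψ ^ 2) * ‖x - xp‖ ^ 2 +
          (8 * ‖grady F xp (ystar μplus xp)‖ ^ 2 / σF ^ 2) * ((μ - μplus) / μ) ^ 2 ∧
      ‖vstar μ x - vstar μplus xp‖ ^ 2 ≤
        (2 * (Lv1 * ‖vstar μ x‖ + Lv2) ^ 2 / σψ ^ 4) * ‖x - xp‖ ^ 2 +
          2 * (Cv1 * ‖vstar μplus xp‖ + Cv2) ^ 2 *
            ‖grady F xp (ystar μplus xp)‖ ^ 2 * ((μ - μplus) / μ ^ 2) ^ 2 := by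
  intro x xp
  have hμ0 : 0 < μ := hμplus.trans_le hle
  have hμI : μ ∈ Icc (0 : ℝ) 1 := ⟨hμ0.le, by linarith⟩
  have hσ : 0 < μ * σF := mul_pos hμ0 hσF
  set y := ystar μ x with hy
  set b := ystar μ xp with hb
  set yp := ystar μplus xp with hyp
  set G := ‖grady F xp yp‖ with hG
  have hG0 : 0 ≤ G := norm_nonneg _
  have hd0 : 0 ≤ μ - μplus := sub_nonneg.2 hle
  have hstat : ∀ μ' ∈ Ioc (0 : ℝ) 1, ∀ z,
      grady (aggreg μ' F f) z (ystar μ' z) = 0 := fun μ' h z =>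
    grady_eq_zero_of_forall_le (hmin μ' h z)
  have hμIoc : μ ∈ Ioc (0 : ℝ) 1 := ⟨hμ0, hμI.2⟩
  have hμpIoc : μplus ∈ Ioc (0 : ℝ) 1 := ⟨hμplus, by linarith⟩
  have hcoer : ∀ μ' ∈ Ioc (0 : ℝ) 1, ∀ z w u, μ' * σF * ‖u‖ ^ 2 ≤
      inner ℝ (hessyy (aggreg μ' F f) z w u) u := by
    intro μ' h z w u
    rw [hessyy_aggreg hF hf]
    exact le_inner_of_hasFDerivAt_of_strongly_monotone (hasFDerivAt_grady_aggreg hF hf μ' z w)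
      (le_inner_grady_aggreg_sub hF hf (Ioc_subset_Icc_self h) (hFsc z) (hfconv z)) u
  have hveq : ∀ μ' ∈ Ioc (0 : ℝ) 1, ∀ z,
      hessyy (aggreg μ' F f) z (ystar μ' z) (vstar μ' z) = grady F z (ystar μ' z) := by
    intro μ' h z
    rw [hvstar]
    exact (ContinuousLinearMap.isInvertible_of_coercive (mul_pos h.1 hσF)
      (hcoer μ' h z _)).self_apply_inverse _
  have hψ0 : 0 ≤ Lψy1 := by
    rw [hLψy1]
    have := sub_nonneg.2 hμI.2
    positivity
  have hψ20 : 0 ≤ Lψyy2 := by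
    rw [hLψyy2]
    have := sub_nonneg.2 hμI.2
    positivity
  -- displacement of the minimizer in the upper-level variable
  have hyb : ‖y - b‖ ≤ Lψy1 / σψ * ‖x - xp‖ := by
    have h1 := mul_norm_le_of_mul_sq_le_inner
      (le_inner_grady_aggreg_sub hF hf hμI (hFsc xp) (hfconv xp) y b)
    have h2 := norm_aggregate_sub_le (hLFy1 y) (hLfy1 y) hμI xp x
    rw [hb, hstat μ hμIoc xp, ← hstat μ hμIoc x, ← hb, ← hy, grady_aggreg hF hf,
      grady_aggreg hF hf] at h1
    rw [← hLψy1, norm_sub_rev xp x] at h2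
    rw [hσψ, div_mul_eq_mul_div, le_div_iff₀ hσ]
    linarith
  -- displacement of the minimizer in the aggregation parameter
  have hbyp : ‖b - yp‖ ≤ 2 * G / σF * ((μ - μplus) / μ) := by
    have h1 := mul_norm_le_of_mul_sq_le_inner
      (le_inner_grady_aggreg_sub hF hf hμI (hFsc xp) (hfconv xp) b yp)
    have h2 := hstat μplus hμpIoc xp
    rw [← hyp, grady_aggreg hF hf] at h2
    rw [hb, hstat μ hμIoc xp, ← hb, zero_sub, norm_neg] at h1
    have h3 : (1 - μplus) • grady (aggreg μ F f) xp yp = (μ - μplus) • grady F xp yp := by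
      have he : (1 - μplus) • (μ • grady F xp yp + (1 - μ) • grady f xp yp) =
          (μ - μplus) • grady F xp yp +
            (1 - μ) • (μplus • grady F xp yp + (1 - μplus) • grady f xp yp) := by module
      rw [grady_aggreg hF hf, he, h2, smul_zero, add_zero]
    have h4 := congrArg norm h3
    rw [norm_smul, norm_smul, Real.norm_of_nonneg hd0, Real.norm_of_nonneg (by linarith),
      ← hG] at h4
    have h5 : ‖grady (aggreg μ F f) xp yp‖ ≤ 2 * ((μ - μplus) * G) := by
      nlinarith [norm_nonneg (grady (aggreg μ F f) xp yp)]
    rw [div_mul_div_comm, le_div_iff₀ (by positivity)]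
    linarith
  refine ⟨?_, ?_⟩
  · refine (sq_norm_sub_le_of_le hyb hbyp).trans_eq ?_
    ring
  set v := vstar μ x with hv
  set w := vstar μ xp with hw
  set vp := vstar μplus xp with hvp
  have hAv : hessyy (aggreg μ F f) x y v = grady F x y := hveq μ hμIoc x
  have hBw : hessyy (aggreg μ F f) xp b w = grady F xp b := hveq μ hμIoc xp
  have hCvp : hessyy (aggreg μplus F f) xp yp vp = grady F xp yp := hveq μplus hμpIoc xp
  have hvw : ‖v - w‖ ≤ (Lv1 * ‖v‖ + Lv2) / σψ ^ 2 * ‖x - xp‖ := by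
    have h1 := mul_norm_le_of_mul_sq_le_inner (hcoer μ hμIoc xp b (v - w))
    have he : hessyy (aggreg μ F f) xp b (v - w) =
        (hessyy (aggreg μ F f) xp b - hessyy (aggreg μ F f) xp y) v +
        (hessyy (aggreg μ F f) xp y - hessyy (aggreg μ F f) x y) v +
        (grady F x y - grady F xp y) + (grady F xp y - grady F xp b) := by
      simp only [map_sub, sub_apply, hAv, hBw]
      abel
    have h2 : ‖(hessyy (aggreg μ F f) xp b - hessyy (aggreg μ F f) xp y) v‖ ≤
        Lψyy2 * ‖y - b‖ * ‖v‖ := by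
      refine ContinuousLinearMap.le_of_opNorm_le _ ?_ v
      rw [hessyy_aggreg hF hf, hessyy_aggreg hF hf, hLψyy2, norm_sub_rev y b]
      exact norm_aggregate_sub_le (hLFyy2 xp) (hLfyy2 xp) hμI b y
    have h3 : ‖(hessyy (aggreg μ F f) xp y - hessyy (aggreg μ F f) x y) v‖ ≤
        Lψyy1 * ‖x - xp‖ * ‖v‖ := by
      refine ContinuousLinearMap.le_of_opNorm_le _ ?_ v
      rw [hessyy_aggreg hF hf, hessyy_aggreg hF hf, hLψyy1, norm_sub_rev x xp]
      exact norm_aggregate_sub_le (hLFyy1 y) (hLfyy1 y) hμI xp x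
    have h4 : ‖grady F x y - grady F xp y‖ ≤ LFy1 * ‖x - xp‖ := (hLFy1 y).norm_sub_le x xp
    have h5 : ‖grady F xp y - grady F xp b‖ ≤ LFy2 * ‖y - b‖ := (hLFy2 xp).norm_sub_le y b
    rw [he] at h1
    have h6 := h1.trans norm_add₄_le
    have h7 : (Lψyy2 * ‖v‖ + LFy2) * ‖y - b‖ ≤
        (Lψyy2 * ‖v‖ + LFy2) * (Lψy1 / σψ * ‖x - xp‖) := by gcongr
    rw [← hσψ] at h6 hσ
    have h8 : σψ * ‖v - w‖ ≤ σψ * ((Lv1 * ‖v‖ + Lv2) / σψ ^ 2 * ‖x - xp‖) := by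
      have h9 : σψ * ((Lv1 * ‖v‖ + Lv2) / σψ ^ 2 * ‖x - xp‖) =
          (Lψyy2 * ‖v‖ + LFy2) * (Lψy1 / σψ * ‖x - xp‖) +
            (Lψyy1 * ‖v‖ + LFy1) * ‖x - xp‖ := by
        rw [hLv1, hLv2]
        field_simp
        ring
      rw [h9]
      linarith
    exact le_of_mul_le_mul_left h8 hσ
  have hwvp : ‖w - vp‖ ≤ (Cv1 * ‖vp‖ + Cv2) * G * ((μ - μplus) / μ ^ 2) := by
    have h1 := mul_norm_le_of_mul_sq_le_inner (hcoer μ hμIoc xp b (w - vp))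
    have he : hessyy (aggreg μ F f) xp b (w - vp) =
        (grady F xp b - grady F xp yp) +
        (hessyy (aggreg μ F f) xp yp - hessyy (aggreg μ F f) xp b) vp +
        -((μ - μplus) • hessyy F xp yp vp) + (μ - μplus) • hessyy f xp yp vp := by
      rw [map_sub, hBw, ← hCvp, hessyy_aggreg hF hf μplus xp yp,
        sub_apply, hessyy_aggreg hF hf μ xp yp]
      simp only [add_apply, smul_apply]
      module
    have h2 : ‖(hessyy (aggreg μ F f) xp yp - hessyy (aggreg μ F f) xp b) vp‖ ≤
        Lψyy2 * ‖b - yp‖ * ‖vp‖ := by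
      refine ContinuousLinearMap.le_of_opNorm_le _ ?_ vp
      rw [hessyy_aggreg hF hf, hessyy_aggreg hF hf, hLψyy2, norm_sub_rev b yp]
      exact norm_aggregate_sub_le (hLFyy2 xp) (hLfyy2 xp) hμI yp b
    have h3 : ‖grady F xp b - grady F xp yp‖ ≤ LFy2 * ‖b - yp‖ := (hLFy2 xp).norm_sub_le b yp
    have h4 : ‖hessyy F xp yp vp‖ ≤ LFy2 * ‖vp‖ :=
      ContinuousLinearMap.le_of_opNorm_le _ (norm_fderiv_le_of_lipschitz ℝ (hLFy2 xp)) vp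
    have h5 : ‖hessyy f xp yp vp‖ ≤ Lfy2 * ‖vp‖ :=
      ContinuousLinearMap.le_of_opNorm_le _ (norm_fderiv_le_of_lipschitz ℝ (hLfy2 xp)) vp
    rw [he] at h1
    have h6 := h1.trans norm_add₄_le
    rw [norm_neg, norm_smul, norm_smul, Real.norm_of_nonneg hd0] at h6
    have h7 : ‖vp‖ ≤ 2 * G / (μ * σF) := by
      have h := mul_norm_le_of_mul_sq_le_inner (hcoer μplus hμpIoc xp yp vp)
      rw [hCvp, ← hG] at h
      rw [le_div_iff₀ hσ]
      have := mul_le_mul_of_nonneg_right hμ2 (mul_nonneg hσF.le (norm_nonneg vp))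
      linarith
    have h8 : Lψyy2 ≤ LFyy2 + Lfyy2 := by
      rw [hLψyy2]
      exact add_le_add (mul_le_of_le_one_left LFyy2.2 hμI.2)
        (mul_le_of_le_one_left Lfyy2.2 (by linarith))
    have h9 : (Lψyy2 * ‖vp‖ + LFy2) * ‖b - yp‖ ≤
        ((LFyy2 + Lfyy2) * ‖vp‖ + LFy2) * (2 * G / σF * ((μ - μplus) / μ)) := by gcongr
    have h10 : (μ - μplus) * ‖hessyy F xp yp vp‖ ≤
        (μ - μplus) * (LFy2 * (2 * G / (μ * σF))) := by
      gcongr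
      exact h4.trans (by gcongr)
    have h11 : (μ - μplus) * ‖hessyy f xp yp vp‖ ≤
        (μ - μplus) * (Lfy2 * (2 * G / (μ * σF))) := by
      gcongr
      exact h5.trans (by gcongr)
    have h12 : μ * σF * ((Cv1 * ‖vp‖ + Cv2) * G * ((μ - μplus) / μ ^ 2)) =
        ((LFyy2 + Lfyy2) * ‖vp‖ + LFy2) * (2 * G / σF * ((μ - μplus) / μ)) +
        (μ - μplus) * (LFy2 * (2 * G / (μ * σF))) +
        (μ - μplus) * (Lfy2 * (2 * G / (μ * σF))) := by
      rw [hCv1, hCv2]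
      field_simp
      ring
    refine le_of_mul_le_mul_left ?_ hσ
    rw [h12]
    linarith
  refine (sq_norm_sub_le_of_le hvw hwvp).trans_eq ?_
  ring
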